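/- arXiv:1907.08626 — 2 statements merged into one kernel-verified Lean document; each statement's English description precedes it below -/
import Mathlib

section
/- Let G be a finite simple graph on n vertices with adjacency matrix A and eigenvalues λ_1 ≥ ... ≥ λ_n (with multiplicity), and let k ≥ 1. Let w_k and W_k be respectively the smallest and the largest diagonal entry of A^k. Then the k-independence number satisfies α_k(G) ≤ min{ |{i : λ_i^k ≥ w_k}| , |{i : λ_i^k ≤ W_k}| }. -/
open Polynomial Matrix

/-- The `k`-independence number of a graph: the maximum size of a set of vertices
such that no walk of length at most `k` joins two distinct vertices of the set
(equivalently, pairwise distance greater than `k`). -/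
noncomputable def kIndepNum {V : Type*} (G : SimpleGraph V) (k : ℕ) : ℕ :=
  sSup {m | ∃ S : Finset V, S.card = m ∧
    ∀ u ∈ S, ∀ v ∈ S, u ≠ v → ∀ w : G.Walk u v, k < w.length}

/-- **Inertia bound**: if a matrix orthogonally diagonalizable with eigenvalues `d` restricts to a
diagonal principal submatrix on `S` with diagonal entries at least `w`, then at least `#S` of its
eigenvalues are at least `w`. -/
theorem card_le_card_filter_le_of_diagonal_submatrix {V : Type*} [Fintype V] [DecidableEq V]
    {M U : Matrix V V ℝ} {d : V → ℝ} (hU : U * Uᵀ = 1) (hM : M = U * diagonal d * Uᵀ)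
    {S : Finset V} {w : ℝ} (hS : ∀ u ∈ S, ∀ v ∈ S, u ≠ v → M u v = 0)
    (hw : ∀ u ∈ S, w ≤ M u u) :
    S.card ≤ (Finset.univ.filter (fun i => w ≤ d i)).card := by
  by_contra! hlt
  set T := Finset.univ.filter (fun i => w ≤ d i) with hT
  let L : (S → ℝ) →ₗ[ℝ] (T → ℝ) := (Uᵀ.submatrix (Subtype.val : T → V) Subtype.val).mulVecLin
  have hker : LinearMap.ker L ≠ ⊥ := LinearMap.ker_ne_bot_of_finrank_lt (by simpa using hlt)
  obtain ⟨y, hy, hy0⟩ := (Submodule.ne_bot_iff _).1 hker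
  let x : V → ℝ := fun v => if h : v ∈ S then y ⟨v, h⟩ else 0
  have hxS (v : V) (hv : v ∉ S) : x v = 0 := by simp [x, hv]
  have hx_sum (f : V → ℝ) : ∑ v, f v * x v = ∑ v : S, f v * y v := by
    rw [← Finset.sum_subset S.subset_univ (by intro v _ hv; simp [hxS v hv]),
      ← Finset.sum_coe_sort]
    exact Finset.sum_congr rfl fun v _ => by simp [x]
  have hc (i : V) (hi : w ≤ d i) : (Uᵀ *ᵥ x) i = 0 := by
    have := congrFun (LinearMap.mem_ker.1 hy) ⟨i, by simpa [hT] using hi⟩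
    simpa [L, mulVec, dotProduct, hx_sum] using this
  have hnorm : x ⬝ᵥ x = (Uᵀ *ᵥ x) ⬝ᵥ (Uᵀ *ᵥ x) := by
    rw [dotProduct_mulVec, vecMul_transpose, mulVec_mulVec, hU, one_mulVec]
  have hquad : x ⬝ᵥ M *ᵥ x = ∑ i, d i * (Uᵀ *ᵥ x) i ^ 2 := by
    rw [hM, ← mulVec_mulVec, ← mulVec_mulVec, dotProduct_mulVec, ← mulVec_transpose]
    simp only [dotProduct, mulVec_diagonal]
    exact Finset.sum_congr rfl fun i _ => by ring
  have hdiag : x ⬝ᵥ M *ᵥ x = ∑ v, M v v * x v ^ 2 := by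
    simp only [dotProduct, mulVec]
    refine Finset.sum_congr rfl fun u _ => ?_
    by_cases hu : u ∈ S
    · rw [Finset.sum_eq_single u _ (by simp)]
      · ring
      · intro v _ hvu
        by_cases hv : v ∈ S
        · simp [hS u hu v hv hvu.symm]
        · simp [hxS v hv]
    · simp [hxS u hu]
  have hlower : w * (x ⬝ᵥ x) ≤ x ⬝ᵥ M *ᵥ x := by
    rw [hdiag, dotProduct, Finset.mul_sum]
    refine Finset.sum_le_sum fun v _ => ?_
    by_cases hv : v ∈ S
    · nlinarith [hw v hv, sq_nonneg (x v)]
    · simp [hxS v hv]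
  have hterm (i : V) : 0 ≤ (w - d i) * (Uᵀ *ᵥ x) i ^ 2 := by
    by_cases hi : w ≤ d i
    · simp [hc i hi]
    · exact mul_nonneg (by linarith) (sq_nonneg _)
  have hsum : ∑ i, (w - d i) * (Uᵀ *ᵥ x) i ^ 2 = w * (x ⬝ᵥ x) - x ⬝ᵥ M *ᵥ x := by
    rw [hquad, hnorm, dotProduct, Finset.mul_sum, ← Finset.sum_sub_distrib]
    exact Finset.sum_congr rfl fun i _ => by ring
  have hzero : ∑ i, (w - d i) * (Uᵀ *ᵥ x) i ^ 2 = 0 :=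
    le_antisymm (by linarith) (Finset.sum_nonneg fun i _ => hterm i)
  have hUx : Uᵀ *ᵥ x = 0 := by
    funext i
    by_cases hi : w ≤ d i
    · exact hc i hi
    · have := (Finset.sum_eq_zero_iff_of_nonneg fun i _ => hterm i).1 hzero i (Finset.mem_univ i)
      simpa [sub_ne_zero.2 (not_le.1 hi).ne'] using this
  have hx : x = 0 := by rw [← one_mulVec x, ← hU, ← mulVec_mulVec, hUx, mulVec_zero]
  exact hy0 (funext fun v => by simpa [x] using congrFun hx v)

/-- Families with the same monic polynomial of roots agree on how many members satisfy `p`. -/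
theorem card_filter_eq_of_prod_X_sub_C_eq {ι R : Type*} [Fintype ι] [CommRing R] [IsDomain R]
    {f g : ι → R} (h : ∏ i, (X - C (f i)) = ∏ i, (X - C (g i))) (p : R → Prop) [DecidablePred p] :
    (Finset.univ.filter fun i => p (f i)).card = (Finset.univ.filter fun i => p (g i)).card := by
  have hroots (f : ι → R) : (∏ i, (X - C (f i))).roots = Finset.univ.val.map f := by
    rw [← roots_multiset_prod_X_sub_C (Finset.univ.val.map f), Multiset.map_map]
    rfl
  have hmap : Finset.univ.val.map f = Finset.univ.val.map g := by rw [← hroots, h, hroots]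
  have hcount := congrArg (Multiset.countP p) hmap
  rwa [Multiset.countP_map, Multiset.countP_map] at hcount

theorem SimpleGraph.adjMatrix_pow_apply_eq_zero {V R : Type*} [Fintype V] [DecidableEq V]
    [Semiring R] (G : SimpleGraph V) [DecidableRel G.Adj] {k : ℕ} {u v : V}
    (h : ∀ p : G.Walk u v, p.length ≠ k) : (G.adjMatrix R ^ k) u v = 0 := by
  have : IsEmpty {p : G.Walk u v | p.length = k} := ⟨fun p => h p.1 p.2⟩
  rw [SimpleGraph.adjMatrix_pow_apply_eq_card_walk, Fintype.card_eq_zero, Nat.cast_zero]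

/-- Cvetković-like bound of Abiad, Cioabă and Tait on the k-independence number. -/
theorem abiad_cioaba_tait_inertia {n : ℕ} (G : SimpleGraph (Fin n)) [DecidableRel G.Adj]
    (k : ℕ) (hk : 1 ≤ k)
    (lam : Fin n → ℝ) (hmono : Antitone lam)
    (hchar : (G.adjMatrix ℝ).charpoly = ∏ i : Fin n, (X - C (lam i)))
    (w W : ℝ)
    (hw : IsLeast (Set.range fun u => ((G.adjMatrix ℝ) ^ k) u u) w)
    (hW : IsGreatest (Set.range fun u => ((G.adjMatrix ℝ) ^ k) u u) W) :
    kIndepNum G k ≤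
      min (Finset.univ.filter (fun i => w ≤ lam i ^ k)).card
          (Finset.univ.filter (fun i => lam i ^ k ≤ W)).card := by
  have hA : (G.adjMatrix ℝ).IsHermitian := by
    rw [IsHermitian, conjTranspose_eq_transpose_of_trivial, G.transpose_adjMatrix]
  let U : Matrix (Fin n) (Fin n) ℝ := hA.eigenvectorUnitary.1
  have hU : U * Uᵀ = 1 := by
    simpa [star_eq_conjTranspose] using Unitary.coe_mul_star_self hA.eigenvectorUnitary
  have hM : G.adjMatrix ℝ ^ k = U * diagonal (fun i => hA.eigenvalues i ^ k) * Uᵀ := by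
    conv_lhs => rw [hA.spectral_theorem, ← map_pow, diagonal_pow, Unitary.conjStarAlgAut_apply]
    rfl
  have hprod : ∏ i, (X - C (hA.eigenvalues i)) = ∏ i, (X - C (lam i)) := by
    rw [← hchar, hA.charpoly_eq]
    rfl
  refine csSup_le' ?_
  rintro _ ⟨S, rfl, hS⟩
  have hzero : ∀ u ∈ S, ∀ v ∈ S, u ≠ v → (G.adjMatrix ℝ ^ k) u v = 0 := fun u hu v hv huv =>
    G.adjMatrix_pow_apply_eq_zero fun p => (hS u hu v hv huv p).ne'
  refine le_min ?_ ?_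
  · rw [← card_filter_eq_of_prod_X_sub_C_eq hprod fun t => w ≤ t ^ k]
    exact card_le_card_filter_le_of_diagonal_submatrix hU hM hzero fun u _ => hw.2 ⟨u, rfl⟩
  · rw [← card_filter_eq_of_prod_X_sub_C_eq hprod fun t => t ^ k ≤ W]
    have hneg : -(G.adjMatrix ℝ ^ k) = U * diagonal (fun i => -hA.eigenvalues i ^ k) * Uᵀ := by
      rw [hM, ← diagonal_neg, mul_neg, neg_mul]
    simpa using card_le_card_filter_le_of_diagonal_submatrix (w := -W) hU hneg
      (fun u hu v hv huv => by simpa using hzero u hu v hv huv)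
      fun u _ => by simpa using hW.2 ⟨u, rfl⟩
end

section
/- For ℓ ≥ 3, let O_ℓ be the odd graph: its vertices are the (ℓ−1)-element subsets of a (2ℓ−1)-element set, two vertices being adjacent exactly when the corresponding subsets are disjoint. Then the 2-independence number satisfies α_2(O_ℓ) ≤ binomial(2ℓ, ℓ)·(ℓ−2) / ( 2·(ℓ + (−1)^ℓ)·(ℓ − 2·(−1)^ℓ) ); that is, α_2(O_ℓ) ≤ binomial(2ℓ,ℓ)/(2(ℓ+1)) when ℓ is even, and α_2(O_ℓ) ≤ binomial(2ℓ,ℓ)·(ℓ−2)/(2(ℓ−1)(ℓ+2)) when ℓ is odd. -/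
open Polynomial Matrix

/-- The odd graph O_ℓ: vertices are the (ℓ-1)-element subsets of a (2ℓ-1)-element
set, two vertices adjacent iff the subsets are disjoint. -/
def oddGraph (l : ℕ) : SimpleGraph {s : Finset (Fin (2 * l - 1)) // s.card = l - 1} :=
  SimpleGraph.fromRel (fun u v => Disjoint u.1 v.1)

open scoped MatrixOrder in
/-- A polynomial that is nonnegative at every eigenvalue of a real symmetric matrix takes it to a
positive semidefinite matrix. -/
theorem Matrix.IsHermitian.posSemidef_aeval {V : Type*} [Fintype V] [DecidableEq V]
    {A : Matrix V V ℝ} (hA : A.IsHermitian) (p : ℝ[X])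
    (hp : ∀ (θ : ℝ) (f : V → ℝ), f ≠ 0 → A *ᵥ f = θ • f → 0 ≤ p.eval θ) :
    (aeval A p).PosSemidef := by
  rw [← Matrix.nonneg_iff_posSemidef, ← cfc_polynomial p A hA]
  refine cfc_nonneg fun θ hθ => ?_
  rw [← Matrix.spectrum_toLin', ← Module.End.hasEigenvalue_iff_mem_spectrum] at hθ
  obtain ⟨f, hf⟩ := hθ.exists_hasEigenvector
  exact hp θ f hf.2 (by simpa using hf.apply_eq_smul)

/-- Weighted ratio bound: a positive semidefinite matrix with constant row sums `c` which is `d`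
times the identity on the index set `S`. -/
theorem Matrix.PosSemidef.mul_card_le {V : Type*} [Fintype V] [DecidableEq V]
    {B : Matrix V V ℝ} (hB : B.PosSemidef) {c d : ℝ} (hd : 0 ≤ d) (hc : B *ᵥ 1 = c • 1)
    {S : Finset V} (hdiag : ∀ u ∈ S, B u u = d)
    (hoff : ∀ u ∈ S, ∀ v ∈ S, u ≠ v → B u v = 0) :
    c * S.card ≤ d * Fintype.card V := by
  classical
  rcases S.eq_empty_or_nonempty with rfl | hS
  · simpa using mul_nonneg hd (Nat.cast_nonneg _)
  set χ : V → ℝ := fun v => if v ∈ S then 1 else 0 with hχ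
  set n : ℝ := (Fintype.card V : ℝ) with hn
  set s : ℝ := (S.card : ℝ) with hs
  have hspos : 0 < s := by simpa [hs] using hS
  have hnpos : 0 < n := hspos.trans_le (Nat.cast_le.2 S.card_le_univ)
  have hχχ : χ ⬝ᵥ B *ᵥ χ = d * s := by
    have (u : V) : χ u * (B *ᵥ χ) u = if u ∈ S then d else 0 := by
      by_cases hu : u ∈ S
      · have : (B *ᵥ χ) u = ∑ v ∈ S, B u v := by
          simp [Matrix.mulVec, dotProduct, hχ, Finset.sum_ite_mem]
        rw [this, Finset.sum_eq_single_of_mem u hu fun v hv hvu => hoff u hu v hv hvu.symm]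
        simp [hχ, hu, hdiag u hu]
      · simp [hχ, hu]
    simp [dotProduct, this, Finset.sum_ite_mem, hs, mul_comm]
  have hχ1 : χ ⬝ᵥ (1 : V → ℝ) = s := by
    simp [hχ, dotProduct, hs]
  have h1χ : (1 : V → ℝ) ⬝ᵥ B *ᵥ χ = c * s := by
    have hT : Bᵀ = B := by simpa [Matrix.IsHermitian] using hB.1
    rw [dotProduct_mulVec, ← mulVec_transpose, hT, hc, smul_dotProduct, dotProduct_comm, hχ1,
      smul_eq_mul]
  have h11 : (1 : V → ℝ) ⬝ᵥ (1 : V → ℝ) = n := by simp [dotProduct, hn]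
  have key := hB.dotProduct_mulVec_nonneg (n • χ - s • 1)
  simp only [star_trivial, mulVec_sub, mulVec_smul, hc, dotProduct_sub, sub_dotProduct,
    smul_dotProduct, dotProduct_smul, smul_eq_mul, hχχ, hχ1, h1χ, h11] at key
  have : 0 ≤ (n * s) * (d * n - c * s) := by linarith
  have := nonneg_of_mul_nonneg_right this (mul_pos hnpos hspos)
  linarith

theorem kIndepNum_spec {V : Type*} [Fintype V] (G : SimpleGraph V) (k : ℕ) :
    ∃ S : Finset V, S.card = kIndepNum G k ∧
      ∀ u ∈ S, ∀ v ∈ S, u ≠ v → ∀ w : G.Walk u v, k < w.length := by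
  refine Nat.sSup_mem (s := {m | ∃ S : Finset V, S.card = m ∧
    ∀ u ∈ S, ∀ v ∈ S, u ≠ v → ∀ w : G.Walk u v, k < w.length}) ⟨0, ∅, by simp⟩
    ⟨Fintype.card V, ?_⟩
  rintro _ ⟨S, rfl, -⟩
  exact S.card_le_univ

/-- Ratio-type bound for the `2`-independence number of a regular graph. -/
theorem SimpleGraph.IsRegularOfDegree.mul_kIndepNum_two_le {V : Type*} [Fintype V] [DecidableEq V]
    {G : SimpleGraph V} [DecidableRel G.Adj] {r : ℕ} (hG : G.IsRegularOfDegree r) {a b : ℝ}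
    (hb : 0 ≤ r + b)
    (hp : ∀ (θ : ℝ) (f : V → ℝ), f ≠ 0 → G.adjMatrix ℝ *ᵥ f = θ • f → 0 ≤ θ ^ 2 + a * θ + b) :
    ((r : ℝ) ^ 2 + a * r + b) * kIndepNum G 2 ≤ (r + b) * Fintype.card V := by
  obtain ⟨S, hS, hw⟩ := kIndepNum_spec G 2
  have hpsd := (G.isHermitian_adjMatrix ℝ).posSemidef_aeval (X ^ 2 + C a * X + C b)
    (by simpa using hp)
  have haeval : aeval (G.adjMatrix ℝ) (X ^ 2 + C a * X + C b) =
      G.adjMatrix ℝ ^ 2 + a • G.adjMatrix ℝ + b • 1 := by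
    simp [Algebra.smul_def]
  rw [haeval] at hpsd
  have h1 : G.adjMatrix ℝ *ᵥ 1 = (r : ℝ) • 1 := by
    ext v
    simp [SimpleGraph.adjMatrix_mulVec_apply, hG.degree_eq v]
  rw [← hS]
  refine hpsd.mul_card_le hb ?_ ?_ ?_
  · simp only [add_mulVec, smul_mulVec, one_mulVec, pow_two, ← mulVec_mulVec, h1, mulVec_smul]
    module
  · intro u _
    have h2 : (G.adjMatrix ℝ ^ 2) u u = r := by
      rw [pow_two, SimpleGraph.adjMatrix_mul_self_apply_self, hG.degree_eq u]
    simp [h2]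
  · intro u hu v hv huv
    have h2 : (G.adjMatrix ℝ ^ 2) u v = 0 := by
      rw [SimpleGraph.adjMatrix_pow_apply_eq_card_walk, Nat.cast_eq_zero, Fintype.card_eq_zero_iff]
      exact ⟨fun w => (hw u hu v hv huv w.1).ne' w.2⟩
    have h1 : ¬ G.Adj u v := fun h => by
      have := hw u hu v hv huv h.toWalk
      simp at this
    simp [h2, h1, huv]

theorem oddGraph_adj {l : ℕ} (hl : 2 ≤ l)
    {u v : {s : Finset (Fin (2 * l - 1)) // s.card = l - 1}} :
    (oddGraph l).Adj u v ↔ Disjoint u.1 v.1 := by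
  simp only [oddGraph, SimpleGraph.fromRel_adj, disjoint_comm (a := v.1), or_self,
    and_iff_right_iff_imp]
  rintro h rfl
  have := u.2
  rw [disjoint_self.1 h] at this
  simp at this
  omega

/-- The number of `(l-1)`-sets that contain `T` and are disjoint from `u`. -/
theorem card_filter_disjoint_superset {l : ℕ} (hl : 2 ≤ l)
    (u : {s : Finset (Fin (2 * l - 1)) // s.card = l - 1}) {T : Finset (Fin (2 * l - 1))} :
    (Finset.univ.filter fun v : {s : Finset (Fin (2 * l - 1)) // s.card = l - 1} =>
      Disjoint u.1 v.1 ∧ T ⊆ v.1).card = if Disjoint T u.1 then l - T.card else 0 := by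
  split_ifs with h
  · have hu : (u.1ᶜ).card = l := by
      rw [Finset.card_compl, u.2, Fintype.card_fin]; omega
    have hT : T ⊆ u.1ᶜ := h.le_compl_right
    trans (u.1ᶜ \ T).card
    swap
    · rw [Finset.card_sdiff_of_subset hT, hu]
    symm
    refine Finset.card_bij (fun x hx => ⟨u.1ᶜ.erase x, ?_⟩) ?_ ?_ ?_
    · rw [Finset.card_erase_of_mem (Finset.sdiff_subset hx), hu]
    · intro x hx
      simp only [Finset.mem_filter, Finset.mem_univ, true_and]
      refine ⟨(disjoint_compl_right (a := u.1)).mono_right (Finset.erase_subset _ _), ?_⟩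
      exact Finset.subset_erase.2 ⟨hT, (Finset.mem_sdiff.1 hx).2⟩
    · intro x hx y hy hxy
      exact Finset.erase_injOn _ (Finset.sdiff_subset hx) (Finset.sdiff_subset hy)
        (congrArg Subtype.val hxy)
    · rintro ⟨v, hv⟩ hmem
      simp only [Finset.mem_filter, Finset.mem_univ, true_and] at hmem
      have hvu : v ⊆ u.1ᶜ := hmem.1.symm.le_compl_right
      obtain ⟨x, hx⟩ : ∃ x, u.1ᶜ \ v = {x} := by
        rw [← Finset.card_eq_one, Finset.card_sdiff_of_subset hvu, hu, hv]; omega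
      have hxm : x ∈ u.1ᶜ \ v := by simp [hx]
      rw [Finset.mem_sdiff] at hxm
      refine ⟨x, Finset.mem_sdiff.2 ⟨hxm.1, fun h => hxm.2 (hmem.2 h)⟩, Subtype.ext ?_⟩
      change u.1ᶜ.erase x = v
      rw [Finset.erase_eq, ← hx, Finset.sdiff_sdiff_eq_self hvu]
  · rw [Finset.card_eq_zero, Finset.filter_eq_empty_iff]
    exact fun v _ hv => h (hv.1.symm.mono_left hv.2)

theorem oddGraph_isRegularOfDegree {l : ℕ} (hl : 2 ≤ l) [DecidableRel (oddGraph l).Adj] :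
    (oddGraph l).IsRegularOfDegree l := fun u => by
  have h := card_filter_disjoint_superset hl u (T := ∅)
  simp only [Finset.empty_subset, and_true, Finset.disjoint_empty_left, if_true,
    Finset.card_empty, Nat.sub_zero] at h
  rw [← SimpleGraph.card_neighborFinset_eq_degree, SimpleGraph.neighborFinset_eq_filter]
  simpa only [oddGraph_adj hl] using h

theorem sum_powerset_neg_one_pow_of_subset {α : Type*} [DecidableEq α] (T u : Finset α) :
    (∑ R ∈ T.powerset, (-1 : ℝ) ^ R.card * if R ⊆ u then 1 else 0) =
      if Disjoint T u then 1 else 0 := by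
  have h : (T.powerset.filter fun R => R ⊆ u) = (T ∩ u).powerset := by
    ext R
    rw [Finset.mem_filter, Finset.mem_powerset, Finset.mem_powerset, Finset.subset_inter_iff]
  simp only [mul_ite, mul_one, mul_zero]
  rw [← Finset.sum_filter, h]
  have := Finset.sum_powerset_neg_one_pow_card (x := T ∩ u)
  simp only [Finset.disjoint_iff_inter_eq_empty]
  exact_mod_cast congrArg (Int.cast : ℤ → ℝ) this

/-- Every eigenvalue of the odd graph is of the form `(-1)^i (l-i)` with `i < l`. -/
theorem oddGraph_eigenvalue {l : ℕ} (hl : 2 ≤ l) [DecidableRel (oddGraph l).Adj] {θ : ℝ}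
    {f : {s : Finset (Fin (2 * l - 1)) // s.card = l - 1} → ℝ} (hf : f ≠ 0)
    (hθ : (oddGraph l).adjMatrix ℝ *ᵥ f = θ • f) :
    ∃ i < l, θ = (-1) ^ i * ((l : ℝ) - i) := by
  by_contra! hne
  let W : Finset (Fin (2 * l - 1)) → ℝ := fun T => ∑ v, if T ⊆ v.1 then f v else 0
  have hW (T) (hT : T.card < l) :
      θ * W T = ((l : ℝ) - T.card) * ∑ R ∈ T.powerset, (-1) ^ R.card * W R := by
    have hcount (u : {s : Finset (Fin (2 * l - 1)) // s.card = l - 1}) :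
        (∑ v : {s : Finset (Fin (2 * l - 1)) // s.card = l - 1},
          if Disjoint u.1 v.1 ∧ T ⊆ v.1 then (1 : ℝ) else 0) =
        ((l : ℝ) - T.card) * if Disjoint T u.1 then 1 else 0 := by
      rw [Finset.sum_boole, card_filter_disjoint_superset hl u]
      split_ifs <;> simp [Nat.cast_sub hT.le]
    calc θ * W T = ∑ v, if T ⊆ v.1 then (θ • f) v else 0 := by
          simp [W, Finset.mul_sum]
      _ = ∑ v : {s : Finset (Fin (2 * l - 1)) // s.card = l - 1}, ∑ u,
          f u * if Disjoint u.1 v.1 ∧ T ⊆ v.1 then (1 : ℝ) else 0 := by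
          rw [← hθ]
          refine Finset.sum_congr rfl fun v _ => ?_
          by_cases h : T ⊆ v.1
          · simp [h, mulVec, dotProduct, oddGraph_adj hl, disjoint_comm (a := v.1)]
          · simp [h]
      _ = ∑ u, f u * (((l : ℝ) - T.card) *
            ∑ R ∈ T.powerset, (-1 : ℝ) ^ R.card * if R ⊆ u.1 then 1 else 0) := by
          rw [Finset.sum_comm]
          simp_rw [← Finset.mul_sum, hcount, sum_powerset_neg_one_pow_of_subset]
      _ = _ := by
          simp_rw [W, Finset.mul_sum]
          rw [Finset.sum_comm]
          refine Finset.sum_congr rfl fun R _ => Finset.sum_congr rfl fun u _ => ?_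
          split_ifs <;> ring
  have hzero (T : Finset (Fin (2 * l - 1))) : T.card < l → W T = 0 := by
    induction T using Finset.strongInduction with
    | H T ih =>
      intro hT
      have h := hW T hT
      rw [Finset.sum_eq_single_of_mem T (Finset.mem_powerset_self T) fun R hR hRT => by
        have hss := (Finset.mem_powerset.1 hR).ssubset_of_ne hRT
        rw [ih R hss ((Finset.card_lt_card hss).trans hT), mul_zero]] at h
      refine (mul_eq_zero.1 ?_).resolve_left (sub_ne_zero.2 (hne T.card hT))
      linear_combination h
  refine hf (funext fun u => ?_)
  have hu := hzero u.1 (by rw [u.2]; omega)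
  have hsub (v : {s : Finset (Fin (2 * l - 1)) // s.card = l - 1}) : u.1 ⊆ v.1 ↔ u = v :=
    ⟨fun h => Subtype.ext (Finset.eq_of_subset_of_card_le h (by rw [u.2, v.2])),
      by rintro rfl; rfl⟩
  simpa [W, hsub] using hu

/-- No eigenvalue of the odd graph lies strictly between `-(-1)^l` and `2(-1)^l`. -/
theorem oddGraph_eigenvalue_quadratic_nonneg {l i : ℕ} (hi : i < l) :
    0 ≤ ((-1 : ℝ) ^ i * ((l : ℝ) - i)) ^ 2 + -(-1) ^ l * ((-1) ^ i * ((l : ℝ) - i)) + -2 := by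
  obtain ⟨m, rfl⟩ := Nat.exists_eq_add_of_lt hi
  have hm : (0 : ℝ) ≤ m := m.cast_nonneg
  have hsq : ((-1 : ℝ) ^ i) ^ 2 = 1 := by rw [← pow_mul, mul_comm, pow_mul]; simp
  have e : ((-1 : ℝ) ^ i * (((i + m + 1 : ℕ) : ℝ) - i)) ^ 2 +
      -(-1) ^ (i + m + 1) * ((-1) ^ i * (((i + m + 1 : ℕ) : ℝ) - i)) + -2 =
      ((m : ℝ) + 1) ^ 2 + (-1) ^ m * (m + 1) - 2 := by
    push_cast
    rw [pow_succ, pow_add]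
    linear_combination (((m : ℝ) + 1) ^ 2 + (-1) ^ m * (m + 1)) * hsq
  rw [e]
  rcases Nat.even_or_odd m with h | h
  · rw [h.neg_one_pow]
    nlinarith
  · have : (1 : ℝ) ≤ m := by exact_mod_cast h.pos
    rw [h.neg_one_pow]
    nlinarith

/-- Bound on the 2-independence number of the odd graph O_ℓ. -/
theorem oddGraph_alpha2 (l : ℕ) (hl : 3 ≤ l) :
    (kIndepNum (oddGraph l) 2 : ℝ) ≤
      (Nat.choose (2 * l) l : ℝ) * ((l : ℝ) - 2) /
        (2 * ((l : ℝ) + (-1 : ℝ) ^ l) * ((l : ℝ) - 2 * (-1 : ℝ) ^ l)) := by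
  classical
  have hreg := oddGraph_isRegularOfDegree (l := l) (by omega)
  have hl' : (3 : ℝ) ≤ l := by exact_mod_cast hl
  have hbound := hreg.mul_kIndepNum_two_le (a := -(-1) ^ l) (b := -2) (by linarith)
    fun θ f hf hθ => by
      obtain ⟨i, hi, rfl⟩ := oddGraph_eigenvalue (by omega) hf hθ
      exact oddGraph_eigenvalue_quadratic_nonneg hi
  have hcard : (Nat.choose (2 * l) l : ℝ) =
      2 * Fintype.card {s : Finset (Fin (2 * l - 1)) // s.card = l - 1} := by
    rw [Fintype.card_finset_len, Fintype.card_fin]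
    obtain ⟨k, rfl⟩ : ∃ k, l = k + 1 := ⟨l - 1, by omega⟩
    have h : (2 * (k + 1)).choose (k + 1) = 2 * (2 * (k + 1) - 1).choose (k + 1 - 1) := by
      rw [show 2 * (k + 1) = 2 * k + 1 + 1 by ring, Nat.choose_succ_succ', Nat.choose_symm_half,
        Nat.add_sub_cancel, Nat.add_sub_cancel, ← two_mul]
    exact_mod_cast h
  have hsq : ((-1 : ℝ) ^ l) ^ 2 = 1 := by rw [← pow_mul, mul_comm, pow_mul]; simp
  have hpos : 0 < 2 * ((l : ℝ) + (-1 : ℝ) ^ l) * ((l : ℝ) - 2 * (-1 : ℝ) ^ l) := by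
    rcases neg_one_pow_eq_or ℝ l with h | h <;> rw [h] <;>
      exact mul_pos (by linarith) (by linarith)
  rw [le_div_iff₀ hpos, hcard]
  linear_combination 2 * hbound - 4 * (kIndepNum (oddGraph l) 2 : ℝ) * hsq
end
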